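/- (Almost analytic extension.) Let ρ ∈ ℝ, φ ∈ S^ρ and l ∈ ℕ. Then there exist a smooth function φ^ℂ : ℂ → ℂ and constants c₁, c₂ > 0 such that: (i) φ^ℂ restricted to ℝ equals φ; (ii) for all z = x + iy ∈ ℂ, |∂̄φ^ℂ(z)| ≤ c₁ ⟨x⟩^{ρ−1−l} |y|^l, where ∂̄ := (1/2)(∂/∂x + i ∂/∂y); (iii) the support of φ^ℂ is contained in {x + iy : |y| ≤ c₂ ⟨x⟩}; (iv) φ^ℂ(x + iy) = 0 whenever x ∉ supp φ. -/

import Mathlib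

/-- Membership in the symbol class `S^ρ`: `φ : ℝ → ℂ` is smooth and for every
`k ∈ ℕ`, `sup_t ⟨t⟩^(k−ρ) ‖φ⁽ᵏ⁾(t)‖ < ∞`, where `⟨t⟩ = (1 + t²)^{1/2}`. -/
def MemSymbolClass (ρ : ℝ) (φ : ℝ → ℂ) : Prop :=
  ContDiff ℝ (⊤ : ℕ∞) φ ∧ ∀ k : ℕ, ∃ C : ℝ, ∀ t : ℝ,
    (1 + t ^ 2) ^ (((k : ℝ) - ρ) / 2) * ‖iteratedDeriv k φ t‖ ≤ C

/-- The Taylor polynomial of degree `l` of `φ` at `x`, evaluated at the increment `i y`. -/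
noncomputable def imaginaryTaylor (φ : ℝ → ℂ) (l : ℕ) (x y : ℝ) : ℂ :=
  ∑ k ∈ Finset.range (l + 1), iteratedDeriv k φ x * ((Complex.I * y) ^ k / (k.factorial : ℂ))

/-- A smooth function equal to `1` on `(-∞, 1]` and to `0` on `[2, ∞)`. -/
noncomputable def unitCutoff (s : ℝ) : ℝ := Real.smoothTransition (2 - s)

/-- The cutoff `χ(y² / ⟨x⟩²)`, supported in `|y| ≤ √2 ⟨x⟩`. -/
noncomputable def conicCutoff (x y : ℝ) : ℝ := unitCutoff (y ^ 2 / (1 + x ^ 2))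

section Calculus

lemma fderiv_one_eq_of_hasDerivAt {f : ℂ → ℂ} {z a : ℂ} (hf : DifferentiableAt ℝ f z)
    (ha : HasDerivAt (fun t : ℝ => f ⟨t, z.im⟩) a z.re) : fderiv ℝ f z 1 = a := by
  have hc : HasDerivAt (fun t : ℝ => (⟨t, z.im⟩ : ℂ)) 1 z.re := by
    have h := (HasDerivAt.ofReal_comp (hasDerivAt_id z.re)).add_const ((z.im : ℂ) * Complex.I)
    refine (h.congr_deriv (by simp)).congr_of_eventuallyEq (.of_forall fun t => ?_)
    simp [Complex.mk_eq_add_mul_I]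
  exact (hf.hasFDerivAt.comp_hasDerivAt z.re hc).unique ha

lemma fderiv_I_eq_of_hasDerivAt {f : ℂ → ℂ} {z b : ℂ} (hf : DifferentiableAt ℝ f z)
    (hb : HasDerivAt (fun t : ℝ => f ⟨z.re, t⟩) b z.im) : fderiv ℝ f z Complex.I = b := by
  have hc : HasDerivAt (fun t : ℝ => (⟨z.re, t⟩ : ℂ)) Complex.I z.im := by
    have h := ((HasDerivAt.ofReal_comp (hasDerivAt_id z.im)).mul_const Complex.I).const_add
      (z.re : ℂ)
    refine (h.congr_deriv (by simp)).congr_of_eventuallyEq (.of_forall fun t => ?_)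
    simp [Complex.mk_eq_add_mul_I]
  exact (hf.hasFDerivAt.comp_hasDerivAt z.im hc).unique hb

lemma ContDiff.iteratedDeriv_infty {φ : ℝ → ℂ} (hφ : ContDiff ℝ (⊤ : ℕ∞) φ) (k : ℕ) :
    ContDiff ℝ (⊤ : ℕ∞) (iteratedDeriv k φ) := by
  rw [iteratedDeriv_eq_iterate]
  exact hφ.iterate_deriv k

lemma hasDerivAt_iteratedDeriv {φ : ℝ → ℂ} (hφ : ContDiff ℝ (⊤ : ℕ∞) φ) (k : ℕ) (x : ℝ) :
    HasDerivAt (iteratedDeriv k φ) (iteratedDeriv (k + 1) φ x) x := by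
  rw [iteratedDeriv_succ]
  exact ((hφ.iteratedDeriv_infty k).differentiable (by simp) x).hasDerivAt

lemma iteratedDeriv_eq_zero_of_notMem_tsupport {φ : ℝ → ℂ} {x : ℝ} (hx : x ∉ tsupport φ)
    (k : ℕ) : iteratedDeriv k φ x = 0 := by
  rw [← norm_eq_zero, ← norm_iteratedFDeriv_eq_norm_iteratedDeriv, norm_eq_zero]
  exact Function.notMem_support.1 fun h => hx (support_iteratedFDeriv_subset k h)

end Calculus

section ImaginaryTaylor

variable {φ : ℝ → ℂ}

@[simp] lemma imaginaryTaylor_zero_right (φ : ℝ → ℂ) (l : ℕ) (x : ℝ) :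
    imaginaryTaylor φ l x 0 = φ x := by
  simp [imaginaryTaylor, Finset.sum_range_succ']

lemma contDiff_imaginaryTaylor (hφ : ContDiff ℝ (⊤ : ℕ∞) φ) (l : ℕ) :
    ContDiff ℝ (⊤ : ℕ∞) fun z : ℂ => imaginaryTaylor φ l z.re z.im := by
  refine ContDiff.sum fun k _ => ?_
  have hre : ContDiff ℝ (⊤ : ℕ∞) fun z : ℂ => z.re := Complex.reCLM.contDiff
  have him : ContDiff ℝ (⊤ : ℕ∞) fun z : ℂ => (z.im : ℂ) :=
    (Complex.ofRealCLM.comp Complex.imCLM).contDiff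
  exact ((hφ.iteratedDeriv_infty k).comp hre).mul (((contDiff_const.mul him).pow k).div_const _)

lemma hasDerivAt_imaginaryTaylor_left (hφ : ContDiff ℝ (⊤ : ℕ∞) φ) (l : ℕ) (x y : ℝ) :
    HasDerivAt (fun t => imaginaryTaylor φ l t y)
      (∑ k ∈ Finset.range (l + 1),
        iteratedDeriv (k + 1) φ x * ((Complex.I * y) ^ k / (k.factorial : ℂ))) x :=
  HasDerivAt.fun_sum fun k _ => (hasDerivAt_iteratedDeriv hφ k x).mul_const _

lemma hasDerivAt_imaginaryTaylor_right (φ : ℝ → ℂ) (l : ℕ) (x y : ℝ) :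
    HasDerivAt (fun t => imaginaryTaylor φ l x t)
      (Complex.I * ∑ k ∈ Finset.range l,
        iteratedDeriv (k + 1) φ x * ((Complex.I * y) ^ k / (k.factorial : ℂ))) y := by
  induction l with
  | zero => simpa [imaginaryTaylor] using hasDerivAt_const y (φ x)
  | succ l ih =>
    have hlin : HasDerivAt (fun t : ℝ => Complex.I * (t : ℂ)) Complex.I y := by
      simpa using (HasDerivAt.ofReal_comp (hasDerivAt_id y)).const_mul Complex.I
    have hterm := ((hlin.pow (l + 1)).div_const ((l + 1).factorial : ℂ)).const_mul
      (iteratedDeriv (l + 1) φ x)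
    have h := ih.add hterm
    refine (h.congr_deriv ?_).congr_of_eventuallyEq (.of_forall fun t => ?_)
    · rw [Finset.sum_range_succ, Nat.factorial_succ]
      have h1 : ((l : ℂ) + 1) ≠ 0 := by exact_mod_cast l.succ_ne_zero
      have h2 : (l.factorial : ℂ) ≠ 0 := by exact_mod_cast l.factorial_ne_zero
      push_cast
      field_simp
    · simp [imaginaryTaylor, Finset.sum_range_succ]

lemma norm_imaginaryTaylor_le {ρ : ℝ} {C : ℕ → ℝ} {l : ℕ} {x y J : ℝ} (hJ : 0 < J)
    (hC : ∀ k, ‖iteratedDeriv k φ x‖ ≤ C k * J ^ (ρ - k)) (hy : |y| ≤ 2 * J) :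
    ‖imaginaryTaylor φ l x y‖ ≤ (∑ k ∈ Finset.range (l + 1), C k * 2 ^ k) * J ^ ρ := by
  rw [Finset.sum_mul]
  refine (norm_sum_le _ _).trans (Finset.sum_le_sum fun k _ => ?_)
  have hfac : (1 : ℝ) ≤ (k.factorial : ℝ) := by exact_mod_cast k.factorial_pos
  have hpow : ‖(Complex.I * y) ^ k / (k.factorial : ℂ)‖ ≤ (2 * J) ^ k := by
    simp only [norm_div, norm_pow, norm_mul, Complex.norm_I, one_mul, Complex.norm_real,
      Real.norm_eq_abs, Complex.norm_natCast]
    exact (div_le_self (by positivity) hfac).trans (by gcongr)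
  calc _ ≤ C k * J ^ (ρ - k) * (2 * J) ^ k := by
        rw [norm_mul]
        exact mul_le_mul (hC k) hpow (norm_nonneg _) ((norm_nonneg _).trans (hC k))
    _ = C k * 2 ^ k * (J ^ (ρ - k) * J ^ (k : ℝ)) := by
        rw [mul_pow, Real.rpow_natCast]; ring
    _ = C k * 2 ^ k * J ^ ρ := by rw [← Real.rpow_add hJ, sub_add_cancel]

end ImaginaryTaylor

section Cutoff

lemma contDiff_unitCutoff : ContDiff ℝ (⊤ : ℕ∞) unitCutoff :=
  Real.smoothTransition.contDiff.comp (contDiff_const.sub contDiff_id)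

lemma unitCutoff_eq_one {s : ℝ} (hs : s ≤ 1) : unitCutoff s = 1 :=
  Real.smoothTransition.one_of_one_le (by linarith)

lemma unitCutoff_eq_zero {s : ℝ} (hs : 2 ≤ s) : unitCutoff s = 0 :=
  Real.smoothTransition.zero_of_nonpos (by linarith)

lemma deriv_unitCutoff_eq_zero {s : ℝ} (hs : s ∉ Set.Icc 1 2) : deriv unitCutoff s = 0 := by
  rw [Set.mem_Icc, not_and_or, not_le, not_le] at hs
  rcases hs with hs | hs
  · have h : unitCutoff =ᶠ[nhds s] fun _ => 1 := by
      filter_upwards [Iio_mem_nhds hs] with t ht using unitCutoff_eq_one (le_of_lt ht)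
    simp [h.deriv_eq]
  · have h : unitCutoff =ᶠ[nhds s] fun _ => 0 := by
      filter_upwards [Ioi_mem_nhds hs] with t ht using unitCutoff_eq_zero (le_of_lt ht)
    simp [h.deriv_eq]

lemma exists_bound_deriv_unitCutoff : ∃ M : ℝ, 0 ≤ M ∧ ∀ s, |deriv unitCutoff s| ≤ M := by
  obtain ⟨M, hM⟩ := (isCompact_Icc (a := (1 : ℝ)) (b := 2)).exists_bound_of_continuousOn
    (contDiff_unitCutoff.continuous_deriv (by simp)).continuousOn
  have hM0 : 0 ≤ M := (norm_nonneg _).trans (hM 1 (by norm_num))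
  refine ⟨M, hM0, fun s => ?_⟩
  by_cases hs : s ∈ Set.Icc (1 : ℝ) 2
  · exact hM s hs
  · simpa [deriv_unitCutoff_eq_zero hs] using hM0

lemma conicCutoff_nonneg (x y : ℝ) : 0 ≤ conicCutoff x y := Real.smoothTransition.nonneg _

lemma conicCutoff_le_one (x y : ℝ) : conicCutoff x y ≤ 1 := Real.smoothTransition.le_one _

@[simp] lemma conicCutoff_zero_right (x : ℝ) : conicCutoff x 0 = 1 :=
  unitCutoff_eq_one (by simp)

lemma conicCutoff_eq_zero {x y : ℝ} (h : 2 * √(1 + x ^ 2) < |y|) : conicCutoff x y = 0 := by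
  have hw : 0 < 1 + x ^ 2 := by positivity
  refine unitCutoff_eq_zero ((le_div_iff₀ hw).2 ?_)
  have hsq := Real.sq_sqrt hw.le
  have := mul_self_le_mul_self (by positivity) h.le
  nlinarith [abs_mul_abs_self y]

lemma contDiff_conicCutoff : ContDiff ℝ (⊤ : ℕ∞) fun z : ℂ => conicCutoff z.re z.im := by
  have hre : ContDiff ℝ (⊤ : ℕ∞) fun z : ℂ => z.re := Complex.reCLM.contDiff
  have him : ContDiff ℝ (⊤ : ℕ∞) fun z : ℂ => z.im := Complex.imCLM.contDiff
  exact contDiff_unitCutoff.comp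
    ((him.pow 2).div (contDiff_const.add (hre.pow 2)) fun z => by positivity)

lemma hasDerivAt_conicCutoff_left (x y : ℝ) :
    HasDerivAt (fun t => conicCutoff t y)
      (deriv unitCutoff (y ^ 2 / (1 + x ^ 2)) * (-(2 * x * y ^ 2) / (1 + x ^ 2) ^ 2)) x := by
  have hw : 1 + x ^ 2 ≠ 0 := by positivity
  have hq : HasDerivAt (fun t : ℝ => y ^ 2 / (1 + t ^ 2))
      (-(2 * x * y ^ 2) / (1 + x ^ 2) ^ 2) x := by
    refine ((hasDerivAt_const x (y ^ 2)).fun_div (((hasDerivAt_pow 2 x)).const_add 1)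
      hw).congr_deriv ?_
    simp; ring
  exact ((contDiff_unitCutoff.differentiable (by simp)) _).hasDerivAt.comp x hq

lemma hasDerivAt_conicCutoff_right (x y : ℝ) :
    HasDerivAt (fun t => conicCutoff x t)
      (deriv unitCutoff (y ^ 2 / (1 + x ^ 2)) * (2 * y / (1 + x ^ 2))) y := by
  have hq : HasDerivAt (fun t : ℝ => t ^ 2 / (1 + x ^ 2)) (2 * y / (1 + x ^ 2)) y := by
    simpa using (hasDerivAt_pow 2 y).div_const (1 + x ^ 2)
  exact ((contDiff_unitCutoff.differentiable (by simp)) _).hasDerivAt.comp y hq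

lemma abs_bounds_of_deriv_unitCutoff_ne_zero {x y : ℝ}
    (h : deriv unitCutoff (y ^ 2 / (1 + x ^ 2)) ≠ 0) :
    √(1 + x ^ 2) ≤ |y| ∧ |y| ≤ 2 * √(1 + x ^ 2) := by
  have hw : 0 < 1 + x ^ 2 := by positivity
  obtain ⟨h1, h2⟩ := by_contra fun hs => h (deriv_unitCutoff_eq_zero hs)
  rw [le_div_iff₀ hw] at h1
  rw [div_le_iff₀ hw] at h2
  have hsq := Real.sq_sqrt hw.le
  constructor
  · exact Real.sqrt_le_iff.2 ⟨abs_nonneg y, by rw [sq_abs]; linarith⟩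
  · refine abs_le_of_sq_le_sq (by nlinarith) (by positivity)

/-- The `∂̄`-derivative of the conic cutoff is `O(⟨x⟩⁻¹)`. -/
lemma norm_dbar_conicCutoff_le {M : ℝ} (hM : ∀ s, |deriv unitCutoff s| ≤ M) {x y : ℝ}
    (hy : |y| ≤ 2 * √(1 + x ^ 2)) :
    |deriv unitCutoff (y ^ 2 / (1 + x ^ 2)) * (-(2 * x * y ^ 2) / (1 + x ^ 2) ^ 2)| +
      |deriv unitCutoff (y ^ 2 / (1 + x ^ 2)) * (2 * y / (1 + x ^ 2))| ≤
      12 * M * (√(1 + x ^ 2))⁻¹ := by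
  have hw : 0 < 1 + x ^ 2 := by positivity
  set J := √(1 + x ^ 2)
  have hJ : 0 < J := Real.sqrt_pos.2 hw
  have hJsq : 1 + x ^ 2 = J ^ 2 := (Real.sq_sqrt hw.le).symm
  have hM0 : 0 ≤ M := (abs_nonneg _).trans (hM 0)
  have hx : |x| ≤ J := abs_le_of_sq_le_sq (by linarith) hJ.le
  have e1 : |-(2 * x * y ^ 2) / (1 + x ^ 2) ^ 2| ≤ 8 * J⁻¹ := by
    rw [hJsq, abs_div, abs_neg, abs_mul, abs_mul, abs_two, abs_pow,
      abs_of_pos (by positivity : 0 < (J ^ 2) ^ 2)]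
    rw [div_le_iff₀ (by positivity)]
    calc 2 * |x| * |y| ^ 2 ≤ 2 * J * (2 * J) ^ 2 := by gcongr
      _ = 8 * J⁻¹ * (J ^ 2) ^ 2 := by field_simp; ring
  have e2 : |2 * y / (1 + x ^ 2)| ≤ 4 * J⁻¹ := by
    rw [hJsq, abs_div, abs_mul, abs_two, abs_of_pos (by positivity : 0 < J ^ 2)]
    rw [div_le_iff₀ (by positivity)]
    calc 2 * |y| ≤ 2 * (2 * J) := by gcongr
      _ = 4 * J⁻¹ * J ^ 2 := by field_simp; ring
  rw [abs_mul, abs_mul]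
  calc _ ≤ M * (8 * J⁻¹) + M * (4 * J⁻¹) := by gcongr <;> exact hM _
    _ = 12 * M * J⁻¹ := by ring

end Cutoff

lemma one_add_sq_rpow_half (x a : ℝ) : (1 + x ^ 2) ^ (a / 2) = √(1 + x ^ 2) ^ a := by
  rw [Real.sqrt_eq_rpow, ← Real.rpow_mul (by positivity)]
  ring_nf

lemma MemSymbolClass.exists_norm_iteratedDeriv_le {ρ : ℝ} {φ : ℝ → ℂ}
    (hφ : MemSymbolClass ρ φ) :
    ∃ C : ℕ → ℝ, (∀ k, 0 ≤ C k) ∧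
      ∀ k x, ‖iteratedDeriv k φ x‖ ≤ C k * √(1 + x ^ 2) ^ (ρ - k) := by
  choose C hC using hφ.2
  refine ⟨C, fun k => le_trans (by positivity) (hC k 0), fun k x => ?_⟩
  have h := hC k x
  have hJ : 0 < √(1 + x ^ 2) := by positivity
  rw [one_add_sq_rpow_half] at h
  rw [← neg_sub, Real.rpow_neg hJ.le, ← div_eq_mul_inv, le_div_iff₀ (by positivity), mul_comm]
  exact h

/-- The algebraic form of `∂̄ (χ F)`, where `χ` is the conic cutoff and `F` the Taylor
polynomial: all terms of `∂̄ F` but the last one cancel. -/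
lemma dbar_conicCutoff_mul_imaginaryTaylor {φ : ℝ → ℂ} (hφ : ContDiff ℝ (⊤ : ℕ∞) φ) (l : ℕ)
    {f : ℂ → ℂ} (hf : f = fun z => (conicCutoff z.re z.im : ℂ) * imaginaryTaylor φ l z.re z.im)
    (hfs : ContDiff ℝ (⊤ : ℕ∞) f) (z : ℂ) :
    fderiv ℝ f z 1 + Complex.I * fderiv ℝ f z Complex.I =
      (((deriv unitCutoff (z.im ^ 2 / (1 + z.re ^ 2)) *
          (-(2 * z.re * z.im ^ 2) / (1 + z.re ^ 2) ^ 2) : ℝ) : ℂ) +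
        Complex.I * ((deriv unitCutoff (z.im ^ 2 / (1 + z.re ^ 2)) *
          (2 * z.im / (1 + z.re ^ 2)) : ℝ) : ℂ)) * imaginaryTaylor φ l z.re z.im +
      (conicCutoff z.re z.im : ℂ) *
        (iteratedDeriv (l + 1) φ z.re * ((Complex.I * z.im) ^ l / (l.factorial : ℂ))) := by
  have hd := hfs.differentiable (by simp) z
  have h1 := fderiv_one_eq_of_hasDerivAt hd (by
    rw [hf]
    exact (hasDerivAt_conicCutoff_left z.re z.im).ofReal_comp.mul
      (hasDerivAt_imaginaryTaylor_left hφ l z.re z.im))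
  have h2 := fderiv_I_eq_of_hasDerivAt hd (by
    rw [hf]
    exact (hasDerivAt_conicCutoff_right z.re z.im).ofReal_comp.mul
      (hasDerivAt_imaginaryTaylor_right φ l z.re z.im))
  rw [h1, h2, Finset.sum_range_succ]
  linear_combination (conicCutoff z.re z.im : ℂ) * (∑ k ∈ Finset.range l,
    iteratedDeriv (k + 1) φ z.re * ((Complex.I * z.im) ^ k / (k.factorial : ℂ))) * Complex.I_sq

/-- **Almost analytic extension.**  Let `φ ∈ S^ρ` and `l ∈ ℕ`.
Then there exist a smooth `φℂ : ℂ → ℂ` and constants `c₁, c₂ > 0` such that: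
(i) `φℂ` restricted to `ℝ` is `φ`;
(ii) `|∂̄ φℂ(z)| ≤ c₁ ⟨Re z⟩^{ρ−1−l} |Im z|^l`, where `∂̄ = (1/2)(∂ₓ + i ∂_y)`;
(iii) `supp φℂ ⊆ {x + i y : |y| ≤ c₂ ⟨x⟩}`;
(iv) `φℂ (x + i y) = 0` whenever `x ∉ supp φ`. -/
theorem almost_analytic_extension
    (ρ : ℝ) (φ : ℝ → ℂ) (hφ : MemSymbolClass ρ φ) (l : ℕ) :
    ∃ (φℂ : ℂ → ℂ) (c₁ c₂ : ℝ), 0 < c₁ ∧ 0 < c₂ ∧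
      ContDiff ℝ (⊤ : ℕ∞) φℂ ∧
      (∀ x : ℝ, φℂ x = φ x) ∧
      (∀ z : ℂ, ‖(fderiv ℝ φℂ z 1 + Complex.I * fderiv ℝ φℂ z Complex.I) / 2‖ ≤
        c₁ * (1 + z.re ^ 2) ^ ((ρ - 1 - (l : ℝ)) / 2) * |z.im| ^ l) ∧
      tsupport φℂ ⊆ {z : ℂ | |z.im| ≤ c₂ * Real.sqrt (1 + z.re ^ 2)} ∧
      (∀ z : ℂ, z.re ∉ tsupport φ → φℂ z = 0) := by
  obtain ⟨C, hC0, hC⟩ := hφ.exists_norm_iteratedDeriv_le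
  obtain ⟨M, hM0, hM⟩ := exists_bound_deriv_unitCutoff
  set K := ∑ k ∈ Finset.range (l + 1), C k * 2 ^ k
  have hK0 : 0 ≤ K := Finset.sum_nonneg fun k _ => mul_nonneg (hC0 k) (by positivity)
  have hsmooth : ContDiff ℝ (⊤ : ℕ∞) fun z : ℂ =>
      (conicCutoff z.re z.im : ℂ) * imaginaryTaylor φ l z.re z.im :=
    (Complex.ofRealCLM.contDiff.comp contDiff_conicCutoff).mul (contDiff_imaginaryTaylor hφ.1 l)
  refine ⟨_, 12 * M * K + C (l + 1) + 1, 2, by linarith [mul_nonneg hM0 hK0, hC0 (l + 1)],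
    two_pos, hsmooth, fun x => by simp, fun z => ?_, ?_, fun z hz => ?_⟩
  · rw [dbar_conicCutoff_mul_imaginaryTaylor hφ.1 l rfl hsmooth z, one_add_sq_rpow_half]
    generalize z.re = x
    generalize z.im = y
    have hJ : 0 < √(1 + x ^ 2) := by positivity
    have hR : 0 ≤ √(1 + x ^ 2) ^ (ρ - 1 - l) * |y| ^ l := by positivity
    have hlast : ‖(conicCutoff x y : ℂ) *
        (iteratedDeriv (l + 1) φ x * ((Complex.I * y) ^ l / (l.factorial : ℂ)))‖ ≤
        C (l + 1) * (√(1 + x ^ 2) ^ (ρ - 1 - l) * |y| ^ l) := by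
      have hfac : (1 : ℝ) ≤ (l.factorial : ℝ) := by exact_mod_cast l.factorial_pos
      have hder := hC (l + 1) x
      rw [show ρ - ((l + 1 : ℕ) : ℝ) = ρ - 1 - l by push_cast; ring] at hder
      simp only [norm_div, norm_pow, norm_mul, Complex.norm_I, one_mul, Complex.norm_real,
        Real.norm_eq_abs, Complex.norm_natCast, abs_of_nonneg (conicCutoff_nonneg x y)]
      calc _ ≤ 1 * (C (l + 1) * √(1 + x ^ 2) ^ (ρ - 1 - l) * |y| ^ l) := by
            gcongr
            · exact conicCutoff_le_one x y
            · exact mul_nonneg (hC0 _) (by positivity)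
            · exact div_le_self (by positivity) hfac
        _ = _ := by ring
    have hcut : ‖(((deriv unitCutoff (y ^ 2 / (1 + x ^ 2)) *
          (-(2 * x * y ^ 2) / (1 + x ^ 2) ^ 2) : ℝ) : ℂ) +
        Complex.I * ((deriv unitCutoff (y ^ 2 / (1 + x ^ 2)) *
          (2 * y / (1 + x ^ 2)) : ℝ) : ℂ)) * imaginaryTaylor φ l x y‖ ≤
        12 * M * K * (√(1 + x ^ 2) ^ (ρ - 1 - l) * |y| ^ l) := by
      by_cases hs : deriv unitCutoff (y ^ 2 / (1 + x ^ 2)) = 0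
      · simpa [hs] using mul_nonneg (by positivity : 0 ≤ 12 * M * K) hR
      obtain ⟨hlow, hup⟩ := abs_bounds_of_deriv_unitCutoff_ne_zero hs
      have hF := norm_imaginaryTaylor_le (l := l) hJ (fun k => hC k x) hup
      have hD := norm_dbar_conicCutoff_le hM hup
      rw [norm_mul]
      calc _ ≤ (12 * M * (√(1 + x ^ 2))⁻¹) * (K * √(1 + x ^ 2) ^ ρ) := by
            refine mul_le_mul ((norm_add_le _ _).trans ?_) hF (norm_nonneg _) (by positivity)
            rw [norm_mul Complex.I, Complex.norm_I, one_mul, Complex.norm_real, Complex.norm_real]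
            exact hD
        _ = 12 * M * K * (√(1 + x ^ 2) ^ (ρ - 1 - l) * √(1 + x ^ 2) ^ l) := by
            rw [← Real.rpow_natCast _ l, ← Real.rpow_add hJ, sub_add_cancel,
              Real.rpow_sub_one hJ.ne']
            ring
        _ ≤ _ := by gcongr
    rw [norm_div, Complex.norm_two]
    have := (norm_add_le _ _).trans (add_le_add hcut hlast)
    refine (half_le_self (norm_nonneg _)).trans (this.trans ?_)
    linarith
  · refine closure_minimal (fun z hz => ?_) (isClosed_le (by fun_prop) (by fun_prop))
    by_contra h
    exact hz (by simp [conicCutoff_eq_zero (not_le.1 h)])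
  · simp [imaginaryTaylor, iteratedDeriv_eq_zero_of_notMem_tsupport hz]
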